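/- arXiv:1706.00090 — 4 statements merged into one kernel-verified Lean document; each statement's English description precedes it below -/
import Mathlib

section
/- Let P and Q be probability measures on a measurable space Ω, and let a : Ω → ℝ be a measurable function taking values in [0, A] for some A > 0. Then ∫ a dQ ≤ ∫ a dP + A · √( D(P ‖ Q) ), where D(P ‖ Q) is the Kullback–Leibler divergence of P with respect to Q. -/
open MeasureTheory ProbabilityTheory Real ENNReal

noncomputable section

attribute [local instance] Classical.propDecidable

/-- The Kullback–Leibler divergence `D(P‖Q) = ∫ log(dP/dQ) dP` (as an extended nonnegative real),
set to `+∞` when `P` is not absolutely continuous w.r.t. `Q` or the log-likelihood ratio is not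
integrable. -/
def klDiv {Ω : Type*} [MeasurableSpace Ω] (P Q : Measure Ω) : ℝ≥0∞ :=
  if P ≪ Q ∧ Integrable (llr P Q) P then ENNReal.ofReal (∫ ω, llr P Q ω ∂P) else ⊤

end

/-- A Fenchel–Young type inequality for `klFun`, with the conjugate bounded by a square. -/
theorem mul_one_sub_le_klFun_add_sq {x s : ℝ} (hx : 0 ≤ x) (hs : |s| ≤ 1) :
    s * (1 - x) ≤ InformationTheory.klFun x + s ^ 2 := by
  have hexp : exp (-s) - 1 + s ≤ s ^ 2 := by
    have h := (abs_le.1 (Real.abs_exp_sub_one_sub_id_le (x := -s) (by simpa using hs))).2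
    linarith [neg_sq s]
  rw [InformationTheory.klFun_apply]
  rcases hx.eq_or_lt with rfl | hx
  · have := exp_pos (-s)
    nlinarith
  · have hlog := Real.log_le_sub_one_of_pos (div_pos (exp_pos (-s)) hx)
    rw [Real.log_div (exp_pos _).ne' hx.ne', Real.log_exp] at hlog
    have hmul := mul_le_mul_of_nonneg_left hlog hx.le
    have hcancel : x * (exp (-s) / x - 1) = exp (-s) - x := by field_simp
    nlinarith

/-- The difference of the means of a `[0, 1]`-valued function under two probability measures has
square at most the Kullback–Leibler divergence. -/
theorem sq_integral_sub_integral_le_integral_llr {Ω : Type*} [MeasurableSpace Ω] {P Q : Measure Ω}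
    [IsProbabilityMeasure P] [IsProbabilityMeasure Q] (hPQ : P ≪ Q)
    (hint : Integrable (llr P Q) P) {b : Ω → ℝ} (hb : Measurable b)
    (hb01 : ∀ ω, b ω ∈ Set.Icc 0 1) :
    (∫ ω, b ω ∂Q - ∫ ω, b ω ∂P) ^ 2 ≤ ∫ ω, llr P Q ω ∂P := by
  set D := ∫ ω, b ω ∂Q - ∫ ω, b ω ∂P with hD
  have hbint (μ : Measure Ω) [IsProbabilityMeasure μ] : Integrable b μ :=
    Integrable.of_mem_Icc 0 1 hb.aemeasurable (ae_of_all _ hb01)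
  have hmean (μ : Measure Ω) [IsProbabilityMeasure μ] :
      ∫ ω, b ω ∂μ ∈ Set.Icc 0 1 := by
    refine ⟨integral_nonneg fun ω => (hb01 ω).1, ?_⟩
    simpa using integral_mono (hbint μ) (integrable_const 1) fun ω => (hb01 ω).2
  have hDabs : |D| ≤ 1 := by
    have hP := hmean P
    have hQ := hmean Q
    exact abs_le.2 ⟨by linarith [hP.2, hQ.1], by linarith [hP.1, hQ.2]⟩
  set f : Ω → ℝ := fun ω => (P.rnDeriv Q ω).toReal with hf
  have hfint : Integrable f Q := Measure.integrable_toReal_rnDeriv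
  have hf_one : ∫ ω, f ω ∂Q = 1 := by simp [hf, Measure.integral_toReal_rnDeriv hPQ]
  have hfb : ∫ ω, f ω * b ω ∂Q = ∫ ω, b ω ∂P := by
    simpa using integral_rnDeriv_smul (f := b) hPQ
  have hfbint : Integrable (fun ω => f ω * b ω) Q := by
    simpa using (integrable_rnDeriv_smul_iff (f := b) hPQ).2 (hbint P)
  have hkl : Integrable (fun ω => InformationTheory.klFun (f ω)) Q :=
    (InformationTheory.integrable_klFun_rnDeriv_iff hPQ).2 hint
  have hkl_eq : ∫ ω, InformationTheory.klFun (f ω) ∂Q = ∫ ω, llr P Q ω ∂P := by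
    simp [hf, InformationTheory.integral_klFun_rnDeriv hPQ hint]
  have hpoint (ω : Ω) : D * (2 * (b ω - f ω * b ω) - (1 - f ω)) ≤
      InformationTheory.klFun (f ω) + D ^ 2 := by
    have hcenter : |2 * b ω - 1| ≤ 1 :=
      abs_le.2 ⟨by linarith [(hb01 ω).1], by linarith [(hb01 ω).2]⟩
    have hs : |D * (2 * b ω - 1)| ≤ |D| := by
      rw [abs_mul]
      exact mul_le_of_le_one_right (abs_nonneg D) hcenter
    have h := mul_one_sub_le_klFun_add_sq (x := f ω) ENNReal.toReal_nonneg (hs.trans hDabs)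
    linarith [sq_le_sq.2 hs]
  have hdiff : Integrable (fun ω => 2 * (b ω - f ω * b ω)) Q :=
    ((hbint Q).sub hfbint).const_mul 2
  have hone : Integrable (fun ω => 1 - f ω) Q := (integrable_const 1).sub hfint
  have h := integral_mono ((hdiff.sub hone).const_mul D) (hkl.add (integrable_const (D ^ 2))) hpoint
  simp only [Pi.sub_apply, Pi.add_apply] at h
  rw [integral_const_mul, integral_sub hdiff hone, integral_const_mul,
    integral_sub (hbint Q) hfbint, integral_sub (integrable_const 1) hfint,
    integral_add hkl (integrable_const _), hkl_eq, hfb, hf_one, ← hD] at h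
  simp only [integral_const, probReal_univ, smul_eq_mul, one_mul, mul_one, sub_self, sub_zero] at h
  linarith

/-- Lemma 3 / Auer et al.: for probability measures `P, Q` and a measurable
`a : Ω → [0, A]`, one has `∫ a dQ ≤ ∫ a dP + A·√(D(P‖Q))`, where the inequality is interpreted in
the extended nonnegative reals (so it holds trivially when `D(P‖Q) = ∞`). -/
theorem change_of_measure_bound {Ω : Type*} [MeasurableSpace Ω] (P Q : Measure Ω)
    [IsProbabilityMeasure P] [IsProbabilityMeasure Q] (A : ℝ) (hA : 0 < A)
    (a : Ω → ℝ) (ha : Measurable a) (hrange : ∀ ω, a ω ∈ Set.Icc 0 A) :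
    (∫⁻ ω, ENNReal.ofReal (a ω) ∂Q) ≤
      (∫⁻ ω, ENNReal.ofReal (a ω) ∂P) + ENNReal.ofReal A * klDiv P Q ^ (1 / 2 : ℝ) := by
  rw [klDiv]
  split_ifs with h
  · obtain ⟨hPQ, hint⟩ := h
    have haint (μ : Measure Ω) [IsProbabilityMeasure μ] : Integrable a μ :=
      Integrable.of_mem_Icc 0 A ha.aemeasurable (ae_of_all _ hrange)
    have ha0 (μ : Measure Ω) : 0 ≤ᵐ[μ] a := ae_of_all _ fun ω => (hrange ω).1
    have hsq := sq_integral_sub_integral_le_integral_llr hPQ hint (ha.div_const A) fun ω =>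
      ⟨div_nonneg (hrange ω).1 hA.le, (div_le_one hA).2 (hrange ω).2⟩
    have hK : 0 ≤ ∫ ω, llr P Q ω ∂P := (sq_nonneg _).trans hsq
    have hsqrt := Real.le_sqrt_of_sq_le hsq
    rw [integral_div, integral_div, ← sub_div, div_le_iff₀ hA] at hsqrt
    rw [← ofReal_integral_eq_lintegral_ofReal (haint Q) (ha0 Q),
      ← ofReal_integral_eq_lintegral_ofReal (haint P) (ha0 P),
      ENNReal.ofReal_rpow_of_nonneg hK (by norm_num), ← Real.sqrt_eq_rpow,
      ← ENNReal.ofReal_mul hA.le,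
      ← ENNReal.ofReal_add (integral_nonneg_of_ae (ha0 P)) (by positivity)]
    exact ENNReal.ofReal_le_ofReal (by linarith)
  · rw [ENNReal.top_rpow_of_pos (by norm_num), ENNReal.mul_top (by simpa using hA)]
    simp
end

section
/- With the needle-in-haystack construction below, there exists a constant C > 0, depending only on d, ζ and h (and not on ε, w, m or M), such that for every index m ∈ {1,…,M}: Σ_{j=1}^M v̄_m^j ≤ C·ε. -/
open MeasureTheory Real

noncomputable section

/-- The `d`-dimensional bump function `H(ξ) = exp(−1/(1−‖ξ‖₂²))` for `‖ξ‖₂ < 1`, `0` otherwise. -/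
def bumpH (d : ℕ) (ξ : Fin d → ℝ) : ℝ :=
  if (∑ i, ξ i ^ 2) < 1 then Real.exp (-1 / (1 - ∑ i, ξ i ^ 2)) else 0

/-- The inverse Fourier transform of `bumpH`, as a complex number:
`∫ H(ξ) e^{2πi⟨x,ξ⟩} dξ`. -/
def bumphC (d : ℕ) (x : Fin d → ℝ) : ℂ :=
  ∫ ξ : Fin d → ℝ, (bumpH d ξ : ℂ) * Complex.exp (2 * Real.pi * Complex.I * (∑ i, x i * ξ i))

/-- The inverse Fourier transform `h` of the bump function `H` (real-valued since `H` is real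
and even). -/
def bumph (d : ℕ) (x : Fin d → ℝ) : ℝ :=
  (bumphC d x).re

/-- The cube of the uniform axis-aligned grid of step `w` indexed by `j ∈ {0,…,K−1}^d`. -/
def gridCube {d K : ℕ} (w : ℝ) (j : Fin d → Fin K) : Set (Fin d → ℝ) :=
  Set.Icc (fun l => (j l : ℝ) * w) (fun l => ((j l : ℝ) + 1) * w)

/-- The center of the grid cube indexed by `j`. -/
def gridCenter {d K : ℕ} (w : ℝ) (j : Fin d → Fin K) : Fin d → ℝ :=
  fun l => ((j l : ℝ) + 1 / 2) * w

/-- The needle function `f_m(x) = g(x − c_m)` with `g(x) = (2ε/h(0)) h(xζ/w)`. -/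
def needle (d : ℕ) (ζ ε w : ℝ) (c : Fin d → ℝ) (x : Fin d → ℝ) : ℝ :=
  (2 * ε / bumph d 0) * bumph d (fun l => (x l - c l) * ζ / w)

/-- `v̄_m^j = sup_{x ∈ R_j} f_m(x)` for the needle construction. -/
def vbar {d K : ℕ} (ζ ε w : ℝ) (m j : Fin d → Fin K) : ℝ :=
  sSup (needle d ζ ε w (gridCenter w m) '' gridCube w j)

end

open scoped FourierTransform SchwartzMap ContDiff

lemma bumpH_ofLp_eq (d : ℕ) (ξ : EuclideanSpace ℝ (Fin d)) :
    bumpH d ξ.ofLp = expNegInvGlue (1 - ‖ξ‖ ^ 2) := by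
  have hsum : ∑ i, ξ i ^ 2 = ‖ξ‖ ^ 2 := by
    simp [EuclideanSpace.norm_sq_eq]
  unfold bumpH expNegInvGlue
  rw [hsum]
  by_cases h : ‖ξ‖ ^ 2 < 1
  · rw [if_pos h, if_neg (by linarith), neg_div, one_div]
  · rw [if_neg h, if_pos (by linarith)]

/-- The bump function as a complex-valued Schwartz function on Euclidean space. -/
noncomputable def bumpSchwartz (d : ℕ) : 𝓢(EuclideanSpace ℝ (Fin d), ℂ) :=
  HasCompactSupport.toSchwartzMap
    (f := fun ξ : EuclideanSpace ℝ (Fin d) => ((expNegInvGlue (1 - ‖ξ‖ ^ 2) : ℝ) : ℂ))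
    (HasCompactSupport.intro (isCompact_closedBall 0 1) fun ξ hξ => by
      have h1 : 1 < ‖ξ‖ := by simpa using hξ
      rw [expNegInvGlue.zero_of_nonpos (by nlinarith), Complex.ofReal_zero])
    (Complex.ofRealCLM.contDiff.comp
      (expNegInvGlue.contDiff.comp (contDiff_const.sub (contDiff_norm_sq ℝ))))

lemma bumphC_eq_fourierInv (d : ℕ) (x : Fin d → ℝ) :
    bumphC d x = (𝓕⁻ (bumpSchwartz d) : 𝓢(EuclideanSpace ℝ (Fin d), ℂ)) (WithLp.toLp 2 x) := by
  rw [SchwartzMap.fourierInv_coe, Real.fourierInv_eq', bumphC,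
    ← (PiLp.volume_preserving_ofLp (Fin d)).integral_comp
      (MeasurableEquiv.toLp 2 (Fin d → ℝ)).symm.measurableEmbedding]
  refine integral_congr_ae (Filter.Eventually.of_forall fun ξ => ?_)
  change (bumpH d ξ.ofLp : ℂ) * _ = _ • ((expNegInvGlue (1 - ‖ξ‖ ^ 2) : ℝ) : ℂ)
  rw [bumpH_ofLp_eq, smul_eq_mul, mul_comm]
  congr 2
  simp only [PiLp.inner_apply, RCLike.inner_apply, conj_trivial]
  push_cast
  ring

lemma exists_abs_bumph_le_prod (d : ℕ) :
    ∃ A : ℝ, 0 ≤ A ∧ ∀ x : Fin d → ℝ, |bumph d x| ≤ A * ∏ l, 1 / (1 + |x l|) ^ 2 := by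
  set F : 𝓢(EuclideanSpace ℝ (Fin d), ℂ) := 𝓕⁻ (bumpSchwartz d) with hF
  set A : ℝ := 2 ^ (2 * d) *
    (Finset.Iic (2 * d, 0)).sup (fun m => SchwartzMap.seminorm ℝ m.1 m.2) F with hA
  refine ⟨A, by positivity, fun x => ?_⟩
  have hdecay : (1 + ‖WithLp.toLp 2 x‖) ^ (2 * d) * ‖F (WithLp.toLp 2 x)‖ ≤ A := by
    simpa using SchwartzMap.one_add_le_sup_seminorm_apply (𝕜 := ℝ) (m := (2 * d, 0))
      (k := 2 * d) (n := 0) le_rfl le_rfl F (WithLp.toLp 2 x)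
  have hprod : ∏ l, (1 + |x l|) ^ 2 ≤ (1 + ‖WithLp.toLp 2 x‖) ^ (2 * d) := by
    calc ∏ l, (1 + |x l|) ^ 2 ≤ ∏ _l : Fin d, (1 + ‖WithLp.toLp 2 x‖) ^ 2 := by
          gcongr with l
          exact PiLp.norm_apply_le (WithLp.toLp 2 x) l
      _ = _ := by simp [pow_mul]
  have hre : |bumph d x| ≤ ‖F (WithLp.toLp 2 x)‖ := by
    rw [bumph, bumphC_eq_fourierInv]
    exact Complex.abs_re_le_norm _
  have hpos : 0 < ∏ l, (1 + |x l|) ^ 2 := Finset.prod_pos fun l _ => by positivity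
  rw [Finset.prod_div_distrib, Finset.prod_const_one, mul_one_div, le_div_iff₀ hpos]
  calc |bumph d x| * ∏ l, (1 + |x l|) ^ 2
      ≤ ‖F (WithLp.toLp 2 x)‖ * (1 + ‖WithLp.toLp 2 x‖) ^ (2 * d) := by gcongr
    _ ≤ A := by rwa [mul_comm]

lemma summable_one_div_one_add_mul_abs_sq {a : ℝ} (ha : 0 < a) :
    Summable fun n : ℤ => 1 / (1 + a * |(n : ℝ)|) ^ 2 := by
  have hs : Summable fun n : ℤ => a⁻¹ ^ 2 * (1 / (n : ℝ) ^ 2) :=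
    (Real.summable_one_div_int_pow.mpr one_lt_two).mul_left _
  refine hs.of_norm_bounded_eventually ?_
  filter_upwards [(Set.finite_singleton (0 : ℤ)).compl_mem_cofinite] with n hn
  have hn0 : 0 < |(n : ℝ)| := by simpa using hn
  rw [Real.norm_of_nonneg (by positivity), ← sq_abs (n : ℝ), inv_pow, ← one_div,
    one_div_mul_one_div, ← mul_pow]
  gcongr
  linarith

lemma abs_int_le_two_mul_abs_add {n : ℤ} {t : ℝ} (ht : |t| ≤ 1 / 2) :
    |(n : ℝ)| ≤ 2 * |n + t| := by
  rcases eq_or_ne n 0 with rfl | hn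
  · simp
  · have h1 : (1 : ℝ) ≤ |(n : ℝ)| := by exact_mod_cast Int.one_le_abs hn
    have h2 : |(n : ℝ)| ≤ |n + t| + |t| := by
      simpa using abs_sub (n + t : ℝ) t
    linarith

/-- On each cube the needle is bounded by a product of one-dimensional weights in the offset
between the index of the cube and the index of the needle. -/
lemma vbar_le_prod {d K : ℕ} {A ζ ε w : ℝ} (hA : 0 ≤ A)
    (hdecay : ∀ x : Fin d → ℝ, |bumph d x| ≤ A * ∏ l, 1 / (1 + |x l|) ^ 2)
    (h0 : 0 < bumph d 0) (hζ : 0 < ζ) (hε : 0 < ε) (hw : 0 < w) (m j : Fin d → Fin K) :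
    vbar ζ ε w m j ≤ 2 * ε / bumph d 0 *
      (A * ∏ l, 1 / (1 + ζ / 2 * |(((j l : ℤ) - (m l : ℤ) : ℤ) : ℝ)|) ^ 2) := by
  have hnn : 0 ≤ ∏ l, 1 / (1 + ζ / 2 * |(((j l : ℤ) - (m l : ℤ) : ℤ) : ℝ)|) ^ 2 :=
    Finset.prod_nonneg fun l _ => by positivity
  refine Real.sSup_le ?_ (by positivity)
  rintro _ ⟨x, ⟨hx1, hx2⟩, rfl⟩
  unfold needle
  gcongr
  refine (le_abs_self _).trans ((hdecay _).trans ?_)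
  gcongr with l
  set n : ℤ := (j l : ℤ) - (m l : ℤ) with hn
  set t : ℝ := x l / w - (j l : ℝ) - 1 / 2 with ht
  have hl : (j l : ℝ) ≤ x l / w := (le_div_iff₀ hw).mpr (hx1 l)
  have hu : x l / w ≤ (j l : ℝ) + 1 := (div_le_iff₀ hw).mpr (hx2 l)
  have habs : |t| ≤ 1 / 2 := abs_le.mpr ⟨by linarith, by linarith⟩
  have harg : (x l - gridCenter w m l) * ζ / w = ζ * (n + t) := by
    rw [hn, ht, gridCenter]
    push_cast
    field_simp
    ring
  rw [harg, abs_mul, abs_of_pos hζ]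
  nlinarith [abs_int_le_two_mul_abs_add (n := n) habs]

lemma sum_prod_sub_le_tsum_pow {d K : ℕ} {φ : ℤ → ℝ} (hφ : Summable φ) (hφ0 : ∀ n, 0 ≤ φ n)
    (m : Fin d → Fin K) :
    ∑ j : Fin d → Fin K, ∏ l, φ ((j l : ℤ) - (m l : ℤ)) ≤ (∑' n, φ n) ^ d := by
  have hsum : ∑ j : Fin d → Fin K, ∏ l, φ ((j l : ℤ) - (m l : ℤ)) =
      ∏ l, ∑ k : Fin K, φ ((k : ℤ) - (m l : ℤ)) := by
    rw [Finset.prod_univ_sum, Fintype.piFinset_univ]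
  rw [hsum]
  calc ∏ l, ∑ k : Fin K, φ ((k : ℤ) - (m l : ℤ)) ≤ ∏ _l : Fin d, ∑' n, φ n := by
        refine Finset.prod_le_prod (fun l _ => Finset.sum_nonneg fun k _ => hφ0 _) fun l _ => ?_
        have hinj : Function.Injective fun k : Fin K => (k : ℤ) - (m l : ℤ) := fun a b hab => by
          ext
          simpa using hab
        rw [← tsum_fintype (L := .unconditional _)]
        exact tsum_comp_le_tsum_of_inj hφ hφ0 hinj
    _ = _ := by simp

/-- Lemma 5, part 1: in the needle-in-haystack construction,
`Σ_{j=1}^M v̄_m^j ≤ C·ε` for a constant `C` depending only on `d`, `ζ` and `h`. -/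
theorem sum_over_regions_vbar_le (d : ℕ) (hd : 1 ≤ d) (ζ : ℝ) (hζ : 0 < ζ)
    (hζprop : ∀ x : Fin d → ℝ, (∃ i, ζ < |x i|) → |bumph d x| < bumph d 0 / 2) :
    ∃ C > (0 : ℝ), ∀ ε w : ℝ, 0 < ε → 0 < w → w < 1 →
      ∀ m : Fin d → Fin (Nat.floor (1 / w)),
        ∑ j : Fin d → Fin (Nat.floor (1 / w)), vbar ζ ε w m j ≤ C * ε := by
  have h0 : 0 < bumph d 0 := by
    have h := hζprop (fun _ => ζ + 1) ⟨⟨0, hd⟩, lt_of_lt_of_le (lt_add_one ζ) (le_abs_self _)⟩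
    linarith [abs_nonneg (bumph d fun _ => ζ + 1)]
  obtain ⟨A, hA, hdecay⟩ := exists_abs_bumph_le_prod d
  set φ : ℤ → ℝ := fun n => 1 / (1 + ζ / 2 * |(n : ℝ)|) ^ 2 with hφ
  have hφ0 : ∀ n, 0 ≤ φ n := fun n => by positivity
  have hsum : Summable φ := summable_one_div_one_add_mul_abs_sq (half_pos hζ)
  have hS : 0 ≤ ∑' n, φ n := tsum_nonneg hφ0
  refine ⟨2 / bumph d 0 * (A * (∑' n, φ n) ^ d) + 1, by positivity, fun ε w hε hw _ m => ?_⟩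
  calc ∑ j, vbar ζ ε w m j
      ≤ ∑ j : Fin d → Fin (Nat.floor (1 / w)),
          2 * ε / bumph d 0 * (A * ∏ l, φ ((j l : ℤ) - (m l : ℤ))) :=
        Finset.sum_le_sum fun j _ => vbar_le_prod hA hdecay h0 hζ hε hw m j
    _ = 2 * ε / bumph d 0 * (A * ∑ j : Fin d → Fin (Nat.floor (1 / w)),
          ∏ l, φ ((j l : ℤ) - (m l : ℤ))) := by
        rw [Finset.mul_sum, Finset.mul_sum]
    _ ≤ 2 * ε / bumph d 0 * (A * (∑' n, φ n) ^ d) := by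
        gcongr
        exact sum_prod_sub_le_tsum_pow hsum hφ0 m
    _ = 2 / bumph d 0 * (A * (∑' n, φ n) ^ d) * ε := by ring
    _ ≤ (2 / bumph d 0 * (A * (∑' n, φ n) ^ d) + 1) * ε := by
        gcongr
        exact le_add_of_nonneg_right zero_le_one
end

section
/- Fix d ≥ 1 and l > 0, and let a₀ > 0 and w₀ > 0 satisfy w₀^{2d} · V(1/w₀) ≤ 1, where V(r) denotes the volume of the Euclidean ball of radius r in ℝ^d. Let g(x) = a₀ · h(x/w₀), so that its Fourier transform is ĝ(ξ) = a₀ w₀^d H(w₀ ξ). Then (2πl²)^{−d/2} ∫_{ℝ^d} |ĝ(ξ)|² e^{2π²l²‖ξ‖₂²} dξ ≤ a₀² (2πl²)^{−d/2} exp( 2π²l² / w₀² ). (Equivalently, the squared RKHS norm of g with respect to the squared-exponential kernel with lengthscale l is at most a₀² (2πl²)^{−d/2} e^{2π²l²/w₀²}.) -/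
open MeasureTheory Real

lemma bumpH_nonneg (d : ℕ) (ξ : Fin d → ℝ) : 0 ≤ bumpH d ξ := by
  unfold bumpH
  split_ifs <;> positivity

lemma bumpH_le_one (d : ℕ) (ξ : Fin d → ℝ) : bumpH d ξ ≤ 1 := by
  unfold bumpH
  split_ifs with h
  · exact Real.exp_le_one_iff.2 (div_nonpos_of_nonpos_of_nonneg (by norm_num) (by linarith))
  · exact zero_le_one

lemma bumpH_smul_eq_zero {d : ℕ} {w : ℝ} (hw : 0 < w) {ξ : Fin d → ℝ}
    (h : (1 / w) ^ 2 ≤ ∑ i, ξ i ^ 2) : bumpH d (fun i => w * ξ i) = 0 := by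
  refine if_neg (not_lt.2 ?_)
  simp only [mul_pow, ← Finset.mul_sum]
  calc (1 : ℝ) = w ^ 2 * (1 / w) ^ 2 := by field_simp
    _ ≤ _ := by gcongr

lemma volume_sum_sq_lt (d : ℕ) {r : ℝ} (hr : 0 < r) :
    volume {ξ : Fin d → ℝ | ∑ i, ξ i ^ 2 < r ^ 2} =
      volume (Metric.ball (0 : EuclideanSpace ℝ (Fin d)) r) := by
  rw [← (PiLp.volume_preserving_toLp (Fin d)).measure_preimage
    measurableSet_ball.nullMeasurableSet, EuclideanSpace.ball_zero_eq r hr.le]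
  rfl

/-- The weighted integral of the rescaled squared bump is at most its support's volume times the
largest value of the weight there. -/
lemma integral_sq_bumpH_mul_exp_le (d : ℕ) {w b : ℝ} (c : ℝ) (hw : 0 < w) (hb : 0 ≤ b) :
    ∫ ξ : Fin d → ℝ, (c * bumpH d (fun i => w * ξ i)) ^ 2 * Real.exp (b * ∑ i, ξ i ^ 2) ≤
      (volume (Metric.ball (0 : EuclideanSpace ℝ (Fin d)) (1 / w))).toReal *
        (c ^ 2 * Real.exp (b / w ^ 2)) := by
  have hr : 0 < 1 / w := by positivity
  set S : Set (Fin d → ℝ) := {ξ | ∑ i, ξ i ^ 2 < (1 / w) ^ 2} with hS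
  have hSm : MeasurableSet S := measurableSet_lt (by fun_prop) measurable_const
  have hvol := volume_sum_sq_lt d hr
  have hfin : volume S ≠ ⊤ := hvol ▸ measure_ball_lt_top.ne
  calc _ ≤ ∫ ξ, S.indicator (fun _ => c ^ 2 * Real.exp (b / w ^ 2)) ξ := by
        refine integral_mono_of_nonneg (.of_forall fun ξ => by positivity)
          ((integrable_indicator_iff hSm).2 (integrableOn_const hfin)) (.of_forall fun ξ => ?_)
        by_cases hξ : ξ ∈ S
        · have h1 := bumpH_nonneg d (fun i => w * ξ i)
          have h2 := bumpH_le_one d (fun i => w * ξ i)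
          have h3 : ∑ i, ξ i ^ 2 ≤ 1 / w ^ 2 := by
            simpa [hS] using (le_of_lt (show ∑ i, ξ i ^ 2 < (1 / w) ^ 2 from hξ))
          have h4 : b * ∑ i, ξ i ^ 2 ≤ b / w ^ 2 := by
            rw [div_eq_mul_one_div]
            gcongr
          simp only [Set.indicator_of_mem hξ]
          rw [mul_pow]
          exact mul_le_mul (mul_le_of_le_one_right (sq_nonneg c) (pow_le_one₀ h1 h2))
            (Real.exp_le_exp.2 h4) (Real.exp_pos _).le (sq_nonneg c)
        · simp [Set.indicator_of_notMem hξ, bumpH_smul_eq_zero hw (not_lt.1 hξ)]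
    _ = _ := by
        rw [integral_indicator hSm, setIntegral_const, measureReal_def, hvol, smul_eq_mul]

/-- bound on the squared SE-RKHS norm of the scaled needle `g(x) = a₀·h(x/w₀)`,
whose Fourier transform is `ĝ(ξ) = a₀ w₀^d H(w₀ξ)`:
`(2πl²)^{−d/2} ∫ |ĝ(ξ)|² e^{2π²l²‖ξ‖₂²} dξ ≤ a₀² (2πl²)^{−d/2} e^{2π²l²/w₀²}`,
assuming `w₀^{2d}·V(1/w₀) ≤ 1` where `V(r)` is the volume of the Euclidean ball of radius `r`. -/
theorem rkhs_norm_bound_SE (d : ℕ) (hd : 1 ≤ d) (l a₀ w₀ : ℝ) (hl : 0 < l) (ha₀ : 0 < a₀)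
    (hw₀ : 0 < w₀)
    (hvol : w₀ ^ (2 * d) *
        (MeasureTheory.volume (Metric.ball (0 : EuclideanSpace ℝ (Fin d)) (1 / w₀))).toReal ≤ 1) :
    (2 * Real.pi * l ^ 2) ^ (-(d : ℝ) / 2) *
        (∫ ξ : Fin d → ℝ, (a₀ * w₀ ^ d * bumpH d (fun i => w₀ * ξ i)) ^ 2 *
          Real.exp (2 * Real.pi ^ 2 * l ^ 2 * ∑ i, ξ i ^ 2)) ≤
      a₀ ^ 2 * (2 * Real.pi * l ^ 2) ^ (-(d : ℝ) / 2) *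
        Real.exp (2 * Real.pi ^ 2 * l ^ 2 / w₀ ^ 2) := by
  have hint := integral_sq_bumpH_mul_exp_le d (b := 2 * Real.pi ^ 2 * l ^ 2) (a₀ * w₀ ^ d) hw₀
    (by positivity)
  rw [mul_comm (a₀ ^ 2), mul_assoc (_ ^ (-(d : ℝ) / 2))]
  refine mul_le_mul_of_nonneg_left (hint.trans ?_) (by positivity)
  calc _ = a₀ ^ 2 * Real.exp (2 * Real.pi ^ 2 * l ^ 2 / w₀ ^ 2) * (w₀ ^ (2 * d) *
        (volume (Metric.ball (0 : EuclideanSpace ℝ (Fin d)) (1 / w₀))).toReal) := by ring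
    _ ≤ _ := mul_le_of_le_one_right (by positivity) hvol
end

section
/- Fix d ≥ 1, l > 0 and ν > 0, and let c₁ = 2^d π^{d/2} Γ(ν+d/2)(2ν)^ν/(Γ(ν) l^{2ν}). There exists a constant c₂ > 0, depending only on d, ν and l, such that for all a₀ > 0 and all w₀ > 0 with 2ν w₀²/l² ≤ 4π², the function g(x) = a₀ · h(x/w₀) (with Fourier transform ĝ(ξ) = a₀ w₀^d H(w₀ ξ)) satisfies c₁^{−1} ∫_{ℝ^d} |ĝ(ξ)|² (2ν/l² + 4π²‖ξ‖₂²)^{ν+d/2} dξ ≤ c₂ · a₀² · w₀^{−2ν} · (8π²)^{ν+d/2}. (Equivalently, the squared RKHS norm of g with respect to the Matérn-ν kernel with lengthscale l is at most c₂ a₀² w₀^{−2ν} (8π²)^{ν+d/2}.) -/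
open MeasureTheory Real

/-- The normalizing constant `c₁` in the Fourier transform of the Matérn-ν kernel. -/
noncomputable def maternC (d : ℕ) (l ν : ℝ) : ℝ :=
  2 ^ d * Real.pi ^ ((d : ℝ) / 2) * Real.Gamma (ν + d / 2) * (2 * ν) ^ ν /
    (Real.Gamma ν * l ^ (2 * ν))

lemma mem_Icc_of_sum_sq_lt_one {d : ℕ} {u : Fin d → ℝ} (h : ∑ i, u i ^ 2 < 1) :
    u ∈ Set.Icc (-1 : Fin d → ℝ) 1 := by
  have key (i : Fin d) : |u i| ≤ 1 := by
    rw [← sq_le_one_iff_abs_le_one]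
    exact (Finset.single_le_sum (f := fun i => u i ^ 2) (fun i _ => sq_nonneg _)
      (Finset.mem_univ i)).trans h.le
  exact ⟨fun i => (abs_le.1 (key i)).1, fun i => (abs_le.1 (key i)).2⟩

lemma maternC_pos (d : ℕ) {l ν : ℝ} (hl : 0 < l) (hν : 0 < ν) : 0 < maternC d l ν := by
  have h₁ : 0 < Real.Gamma (ν + d / 2) := Real.Gamma_pos_of_pos (by positivity)
  have h₂ : 0 < Real.Gamma ν := Real.Gamma_pos_of_pos hν
  unfold maternC
  positivity

/-- On the support of `bumpH d (w • ·)` the Matérn spectral weight is at most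
`(8π² / w²) ^ s`. -/
lemma bumpH_sq_mul_rpow_le {d : ℕ} {l ν s w : ℝ} (hν : 0 < ν) (hs : 0 ≤ s) (hw : 0 < w)
    (h : 2 * ν * w ^ 2 / l ^ 2 ≤ 4 * Real.pi ^ 2) (ξ : Fin d → ℝ) :
    bumpH d (w • ξ) ^ 2 * (2 * ν / l ^ 2 + 4 * Real.pi ^ 2 * ∑ i, ξ i ^ 2) ^ s ≤
      (Set.Icc (-1 : Fin d → ℝ) 1).indicator
        (fun _ => (8 * Real.pi ^ 2) ^ s * w ^ (-(2 * s))) (w • ξ) := by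
  have hS : 0 ≤ ∑ i, ξ i ^ 2 := Finset.sum_nonneg fun i _ => sq_nonneg _
  by_cases hu : ∑ i, (w • ξ) i ^ 2 < 1
  · rw [Set.indicator_of_mem (mem_Icc_of_sum_sq_lt_one hu)]
    have hsum : ∑ i, (w • ξ) i ^ 2 = w ^ 2 * ∑ i, ξ i ^ 2 := by
      simp [mul_pow, Finset.mul_sum]
    rw [hsum] at hu
    have hbase : 2 * ν / l ^ 2 + 4 * Real.pi ^ 2 * ∑ i, ξ i ^ 2 ≤ 8 * Real.pi ^ 2 / w ^ 2 := by
      rw [le_div_iff₀ (by positivity)]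
      calc (2 * ν / l ^ 2 + 4 * Real.pi ^ 2 * ∑ i, ξ i ^ 2) * w ^ 2
          = 2 * ν * w ^ 2 / l ^ 2 + 4 * Real.pi ^ 2 * (w ^ 2 * ∑ i, ξ i ^ 2) := by ring
        _ ≤ 4 * Real.pi ^ 2 + 4 * Real.pi ^ 2 * 1 := by gcongr
        _ = 8 * Real.pi ^ 2 := by ring
    calc bumpH d (w • ξ) ^ 2 * (2 * ν / l ^ 2 + 4 * Real.pi ^ 2 * ∑ i, ξ i ^ 2) ^ s
        ≤ 1 * (8 * Real.pi ^ 2 / w ^ 2) ^ s := by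
          gcongr
          exact pow_le_one₀ (bumpH_nonneg _ _) (bumpH_le_one _ _)
      _ = (8 * Real.pi ^ 2) ^ s * w ^ (-(2 * s)) := by
          rw [one_mul, Real.div_rpow (by positivity) (by positivity), ← Real.rpow_natCast w 2,
            ← Real.rpow_mul hw.le, Real.rpow_neg hw.le, div_eq_mul_inv, Nat.cast_ofNat]
  · rw [bumpH, if_neg hu]
    simp only [ne_eq, OfNat.ofNat_ne_zero, not_false_eq_true, zero_pow, zero_mul]
    exact Set.indicator_nonneg (fun _ _ => by positivity) _

/-- bound on the squared Matérn-RKHS norm of the scaled needle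
`g(x) = a₀·h(x/w₀)`, whose Fourier transform is `ĝ(ξ) = a₀ w₀^d H(w₀ξ)`:
`c₁⁻¹ ∫ |ĝ(ξ)|² (2ν/l² + 4π²‖ξ‖₂²)^{ν+d/2} dξ ≤ c₂ a₀² w₀^{−2ν} (8π²)^{ν+d/2}`,
whenever `2νw₀²/l² ≤ 4π²`. -/
theorem rkhs_norm_bound_Matern (d : ℕ) (hd : 1 ≤ d) (l ν : ℝ) (hl : 0 < l) (hν : 0 < ν) :
    ∃ c₂ > (0 : ℝ), ∀ a₀ w₀ : ℝ, 0 < a₀ → 0 < w₀ →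
      2 * ν * w₀ ^ 2 / l ^ 2 ≤ 4 * Real.pi ^ 2 →
      (maternC d l ν)⁻¹ *
          (∫ ξ : Fin d → ℝ, (a₀ * w₀ ^ d * bumpH d (fun i => w₀ * ξ i)) ^ 2 *
            (2 * ν / l ^ 2 + 4 * Real.pi ^ 2 * ∑ i, ξ i ^ 2) ^ (ν + (d : ℝ) / 2)) ≤
        c₂ * a₀ ^ 2 * w₀ ^ (-(2 * ν)) * (8 * Real.pi ^ 2) ^ (ν + (d : ℝ) / 2) := by
  have hC := maternC_pos d hl hν
  refine ⟨(maternC d l ν)⁻¹ * 2 ^ d, by positivity, fun a w ha hw h => ?_⟩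
  set s : ℝ := ν + (d : ℝ) / 2 with hs
  set I : (Fin d → ℝ) → ℝ := (Set.Icc (-1 : Fin d → ℝ) 1).indicator
    (fun _ => (8 * Real.pi ^ 2) ^ s * w ^ (-(2 * s))) with hI
  have hI_int : Integrable I :=
    (integrable_indicator_iff measurableSet_Icc).2 (integrableOn_const (by
      simp [Real.volume_Icc_pi]))
  have hI_val : ∫ u, I u = 2 ^ d * ((8 * Real.pi ^ 2) ^ s * w ^ (-(2 * s))) := by
    rw [hI, integral_indicator measurableSet_Icc, setIntegral_const, smul_eq_mul, measureReal_def,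
      Real.volume_Icc_pi_toReal (fun i => by simp)]
    norm_num
  have hbound : ∫ ξ : Fin d → ℝ, (a * w ^ d * bumpH d (fun i => w * ξ i)) ^ 2 *
      (2 * ν / l ^ 2 + 4 * Real.pi ^ 2 * ∑ i, ξ i ^ 2) ^ s ≤
      ∫ ξ : Fin d → ℝ, (a * w ^ d) ^ 2 * I (w • ξ) := by
    refine integral_mono_of_nonneg (.of_forall fun ξ => ?_)
      ((hI_int.comp_smul hw.ne').const_mul _) (.of_forall fun ξ => ?_)
    · have : 0 ≤ ∑ i, ξ i ^ 2 := Finset.sum_nonneg fun i _ => sq_nonneg _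
      simp only [Pi.zero_apply]
      positivity
    · simp only [mul_pow _ (bumpH _ _), mul_assoc ((a * w ^ d) ^ 2)]
      exact mul_le_mul_of_nonneg_left
        (bumpH_sq_mul_rpow_le hν (by positivity) hw h ξ) (by positivity)
  have hpow : (w ^ d) ^ 2 * ((w ^ d)⁻¹ * w ^ (-(2 * s))) = w ^ (-(2 * ν)) := by
    have : -(2 * ν) = -(2 * s) + (d : ℝ) := by rw [hs]; ring
    rw [this, Real.rpow_add hw, Real.rpow_natCast]
    field_simp
  rw [integral_const_mul, Measure.integral_comp_smul, hI_val, Module.finrank_fin_fun,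
    abs_of_pos (by positivity), smul_eq_mul] at hbound
  calc _ ≤ (maternC d l ν)⁻¹ * _ := mul_le_mul_of_nonneg_left hbound (by positivity)
    _ = (maternC d l ν)⁻¹ * 2 ^ d * a ^ 2 *
        ((w ^ d) ^ 2 * ((w ^ d)⁻¹ * w ^ (-(2 * s)))) * (8 * Real.pi ^ 2) ^ s := by ring
    _ = _ := by rw [hpow]
end
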